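/- Fix k ≥ 1 and let C : ℕ → Set ℤ be any surjective enumeration of the family of languages {ℤ \ F : F ⊆ ℤ finite with |F| ≤ k}. Then C is (k+1)-list identifiable in the limit but not k-list identifiable in the limit. In particular, for every k ≥ 1 there exists a countable language collection that is (k+1)-list identifiable in the limit but not k-list identifiable in the limit. -/

import Mathlib

/-- `x : ℕ → U` is an enumeration of the language `L ⊆ U`. -/
def IsEnumeration {U : Type*} (L : Set U) (x : ℕ → U) : Prop :=
  (∀ n, x n ∈ L) ∧ ∀ u ∈ L, ∃ n, x n = u

/-- The finite sequence consisting of the first `t` values of `x`. -/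
def prefixList {U : Type*} (x : ℕ → U) (t : ℕ) : List U :=
  List.ofFn (fun j : Fin t => x j)

/-- `A` is a `k`-list identifier that identifies the collection `C` in the limit. -/
def IdentifiesInLimit {U : Type*} (C : ℕ → Set U) (k : ℕ) (A : List U → Finset ℕ) : Prop :=
  (∀ s, (A s).card ≤ k) ∧
  ∀ z : ℕ, ∀ x : ℕ → U, IsEnumeration (C z) x →
    ∃ tStar : ℕ, ∀ t ≥ tStar, ∃ i ∈ A (prefixList x t), C i = C z

/-- The collection `C` is `k`-list identifiable in the limit. -/
def ListIdentifiable {U : Type*} (C : ℕ → Set U) (k : ℕ) : Prop :=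
  ∃ A : List U → Finset ℕ, IdentifiesInLimit C k A

/-- A finite set `F` of unseen points that is downward closed, for the order given by the
encoding, among the points not occurring in the sample `s`. -/
def IsInitialUnseen {U : Type*} [Encodable U] (s : List U) (F : Finset U) : Prop :=
  (∀ a ∈ F, a ∉ s) ∧
    ∀ a ∈ F, ∀ b, Encodable.encode b ≤ Encodable.encode a → b ∈ F ∨ b ∈ s

theorem IsInitialUnseen.eq_of_card_eq {U : Type*} [Encodable U] {s : List U} {F G : Finset U}
    (hF : IsInitialUnseen s F) (hG : IsInitialUnseen s G) (h : F.card = G.card) : F = G := by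
  by_contra hne
  have hFG : ¬ F ⊆ G := fun hs => hne (Finset.eq_of_subset_of_card_le hs h.ge)
  have hGF : ¬ G ⊆ F := fun hs => hne (Finset.eq_of_subset_of_card_le hs h.le).symm
  obtain ⟨f, hf, hfG⟩ := Finset.not_subset.1 hFG
  obtain ⟨g, hg, hgF⟩ := Finset.not_subset.1 hGF
  rcases le_total (Encodable.encode f) (Encodable.encode g) with hle | hle
  · exact (hG.2 g hg f hle).elim hfG (hF.1 f hf)
  · exact (hF.2 f hf g hle).elim hgF (hG.1 g hg)

theorem mem_prefixList {U : Type*} {x : ℕ → U} {t : ℕ} {a : U} :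
    a ∈ prefixList x t ↔ ∃ n < t, x n = a := by
  simp only [prefixList, List.mem_ofFn, Fin.exists_iff, exists_prop]

theorem IsEnumeration.eventually_isInitialUnseen {U : Type*} [Encodable U] {F : Finset U}
    {x : ℕ → U} (hx : IsEnumeration (↑F : Set U)ᶜ x) :
    ∃ T, ∀ t ≥ T, IsInitialUnseen (prefixList x t) F := by
  have hex : ∀ b : U, ∃ n, b ∉ F → x n = b := fun b => by
    by_cases hb : b ∈ F
    · exact ⟨0, fun h => absurd hb h⟩
    · obtain ⟨n, hn⟩ := hx.2 b (by simpa using hb)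
      exact ⟨n, fun _ => hn⟩
  choose n hn using hex
  have hfin : {b : U | Encodable.encode b ≤ F.sup Encodable.encode}.Finite :=
    (Set.finite_Iic _).preimage Encodable.encode_injective.injOn
  obtain ⟨T, hT⟩ := (hfin.image n).bddAbove
  refine ⟨T + 1, fun t ht => ⟨fun a ha hmem => ?_, fun a ha b hb => ?_⟩⟩
  · obtain ⟨m, -, rfl⟩ := mem_prefixList.1 hmem
    exact hx.1 m (by simpa using ha)
  · by_cases hbF : b ∈ F
    · exact Or.inl hbF
    · have hle : n b ≤ T := hT ⟨b, hb.trans (Finset.le_sup (f := Encodable.encode) ha), rfl⟩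
      exact Or.inr (mem_prefixList.2 ⟨n b, by omega, hn b hbF⟩)

theorem listIdentifiable_of_compl_finset {U : Type*} [Encodable U] {k : ℕ} {C : ℕ → Set U}
    (hrange : ∀ i, ∃ F : Finset U, F.card ≤ k ∧ C i = (↑F : Set U)ᶜ) :
    ListIdentifiable C (k + 1) := by
  classical
  let Q : List U → ℕ → ℕ → Prop := fun s j i =>
    ∃ F : Finset U, F.card = j ∧ IsInitialUnseen s F ∧ C i = (↑F : Set U)ᶜ
  let guess : List U → ℕ → ℕ := fun s j => if h : ∃ i, Q s j i then h.choose else 0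
  refine ⟨fun s => (Finset.range (k + 1)).image (guess s),
    fun s => Finset.card_image_le.trans (Finset.card_range _).le, fun z x hx => ?_⟩
  obtain ⟨F, hFk, hF⟩ := hrange z
  rw [hF] at hx
  obtain ⟨T, hT⟩ := hx.eventually_isInitialUnseen
  refine ⟨T, fun t ht => ⟨_, Finset.mem_image_of_mem _
    (Finset.mem_range.2 (Nat.lt_succ_of_le hFk)), ?_⟩⟩
  have h : ∃ i, Q (prefixList x t) F.card i := ⟨z, F, rfl, hT t ht, hF⟩
  have hguess : guess (prefixList x t) F.card = h.choose := dif_pos h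
  obtain ⟨G, hGcard, hG, hCG⟩ := h.choose_spec
  rw [hguess, hCG, hF, hG.eq_of_card_eq (hT t ht) hGcard]

/-- A strictly growing chain of lists is a chain of prefixes of a single sequence. -/
theorem exists_prefixList_eq {U : Type*} (s : ℕ → List U) (hs : ∀ n, s n <+: s (n + 1))
    (hlen : ∀ n, n ≤ (s n).length) : ∃ x : ℕ → U, ∀ n, prefixList x (s n).length = s n := by
  have hmono : ∀ {m n}, m ≤ n → s m <+: s n := fun {m n} h => by
    induction n, h using Nat.le_induction with
    | base => exact List.prefix_rfl
    | succ n _ ih => exact ih.trans (hs n)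
  refine ⟨fun n => (s (n + 1))[n]'(hlen (n + 1)), fun n => ?_⟩
  refine List.ext_getElem (by simp [prefixList]) fun i h₁ h₂ => ?_
  simp only [prefixList, List.getElem_ofFn]
  rcases le_total (i + 1) n with h | h
  · exact (hmono h).getElem _
  · exact ((hmono h).getElem _).symm

/-- If every list over `L` extending `σ` can be extended within `L` so that `P` fails, then some
enumeration of `L` has infinitely many prefixes at which `P` fails. -/
theorem exists_isEnumeration_frequently_not {U : Type*} [Countable U] {L : Set U}
    (hL : L.Nonempty) {P : List U → Prop} {σ : List U} (hσ : ∀ a ∈ σ, a ∈ L)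
    (h : ∀ τ, σ <+: τ → (∀ a ∈ τ, a ∈ L) → ∃ ρ, (∀ a ∈ ρ, a ∈ L) ∧ ¬ P (τ ++ ρ)) :
    ∃ x, IsEnumeration L x ∧ ∀ T, ∃ t ≥ T, ¬ P (prefixList x t) := by
  obtain ⟨u, hu⟩ := L.to_countable.exists_eq_range hL
  have huL : ∀ n, u n ∈ L := fun n => hu ▸ Set.mem_range_self n
  let S := {τ : List U // σ <+: τ ∧ ∀ a ∈ τ, a ∈ L}
  have hstep : ∀ (n : ℕ) (τ : S), ∃ τ' : S, τ.1 ++ [u n] <+: τ'.1 ∧ ¬ P τ'.1 := by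
    rintro n ⟨τ, hτ, hτL⟩
    have hmem : ∀ a ∈ τ ++ [u n], a ∈ L := by
      simp only [List.mem_append, List.mem_singleton]
      rintro a (ha | rfl)
      exacts [hτL a ha, huL n]
    have hpre : σ <+: τ ++ [u n] := hτ.trans (List.prefix_append _ _)
    obtain ⟨ρ, hρ, hP⟩ := h _ hpre hmem
    exact ⟨⟨τ ++ [u n] ++ ρ, hpre.trans (List.prefix_append _ _),
      fun a ha => (List.mem_append.1 ha).elim (hmem a) (hρ a)⟩, List.prefix_append _ _, hP⟩
  choose next hnext hnextP using hstep
  let s : ℕ → S := fun n => Nat.rec ⟨σ, List.prefix_rfl, hσ⟩ next n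
  have hsucc : ∀ n, (s n).1 ++ [u n] <+: (s (n + 1)).1 := fun n => hnext n (s n)
  have hlen : ∀ n, n ≤ (s n).1.length := fun n => by
    induction n with
    | zero => exact Nat.zero_le _
    | succ n ih =>
      have := (hsucc n).length_le
      simp only [List.length_append, List.length_singleton] at this
      omega
  obtain ⟨x, hx⟩ := exists_prefixList_eq (fun n => (s n).1)
    (fun n => (List.prefix_append _ _).trans (hsucc n)) hlen
  refine ⟨x, ⟨fun n => (s (n + 1)).2.2 _ ?_, fun a ha => ?_⟩,
    fun T => ⟨_, (Nat.le_succ T).trans (hlen (T + 1)), ?_⟩⟩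
  · rw [← hx (n + 1)]
    exact mem_prefixList.2 ⟨n, hlen (n + 1), rfl⟩
  · rw [hu] at ha
    obtain ⟨n, rfl⟩ := ha
    have hmem : u n ∈ (s (n + 1)).1 := (hsucc n).subset (by simp)
    rw [← hx (n + 1)] at hmem
    obtain ⟨m, -, hm⟩ := mem_prefixList.1 hmem
    exact ⟨m, hm⟩
  · rw [hx (T + 1)]
    exact hnextP T (s T)

/-- Every list over `C z` extends to a locking sequence: after it, the identifier never drops
`C z` as long as the data come from `C z`. -/
theorem IdentifiesInLimit.exists_locking {U : Type*} [Countable U] {C : ℕ → Set U} {k : ℕ}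
    {A : List U → Finset ℕ} (hA : IdentifiesInLimit C k A) {z : ℕ} (hz : (C z).Nonempty)
    {σ : List U} (hσ : ∀ a ∈ σ, a ∈ C z) :
    ∃ τ, σ <+: τ ∧ (∀ a ∈ τ, a ∈ C z) ∧
      ∀ ρ, (∀ a ∈ ρ, a ∈ C z) → ∃ i ∈ A (τ ++ ρ), C i = C z := by
  by_contra hcon
  obtain ⟨x, hx, hfail⟩ := exists_isEnumeration_frequently_not hz
    (P := fun s => ∃ i ∈ A s, C i = C z) hσ fun τ hτ hτL => by
      by_contra hno
      exact hcon ⟨τ, hτ, hτL, fun ρ hρ => by_contra fun hP => hno ⟨ρ, hρ, hP⟩⟩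
  obtain ⟨T, hT⟩ := hA.2 z x hx
  obtain ⟨t, ht, hP⟩ := hfail T
  exact hP (hT t ht)

/-- Inductively, some list forces the identifier to keep `j + 1` distinct languages. -/
theorem IdentifiesInLimit.exists_forcing {U : Type*} [Countable U] [Infinite U]
    {C : ℕ → Set U} {k m : ℕ} {A : List U → Finset ℕ} (hA : IdentifiesInLimit C m A)
    (hsurj : ∀ F : Finset U, F.card ≤ k → ∃ i, C i = (↑F : Set U)ᶜ) {j : ℕ} (hj : j ≤ k) :
    ∃ (F : Finset U) (𝓕 : Finset (Finset U)) (σ : List U),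
      F.card = j ∧ 𝓕.card = j + 1 ∧ (∀ G ∈ 𝓕, G ⊆ F) ∧ (∀ a ∈ σ, a ∉ F) ∧
      ∀ ρ : List U, (∀ a ∈ ρ, a ∉ F) →
        ∀ G ∈ 𝓕, ∃ i ∈ A (σ ++ ρ), C i = (↑G : Set U)ᶜ := by
  classical
  have lock : ∀ (F : Finset U) (σ : List U), F.card ≤ k → (∀ a ∈ σ, a ∉ F) →
      ∃ τ, σ <+: τ ∧ (∀ a ∈ τ, a ∉ F) ∧
        ∀ ρ : List U, (∀ a ∈ ρ, a ∉ F) → ∃ i ∈ A (τ ++ ρ), C i = (↑F : Set U)ᶜ := by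
    intro F σ hF hσ
    obtain ⟨z, hz⟩ := hsurj F hF
    have hne : (C z).Nonempty := hz ▸ F.finite_toSet.infinite_compl.nonempty
    simpa [hz] using hA.exists_locking hne (σ := σ) (by simpa [hz] using hσ)
  induction j with
  | zero =>
    obtain ⟨τ, -, hτ, hlock⟩ := lock ∅ [] (by simp) (by simp)
    exact ⟨∅, {∅}, τ, rfl, rfl, by simp, hτ, fun ρ hρ G hG => by
      rw [Finset.mem_singleton.1 hG]
      exact hlock ρ hρ⟩
  | succ j ih =>
    obtain ⟨F, 𝓕, σ, hF, h𝓕, hsub, hσ, hforce⟩ := ih (by omega)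
    obtain ⟨a, ha⟩ := Infinite.exists_notMem_finset (F ∪ σ.toFinset)
    simp only [Finset.mem_union, List.mem_toFinset, not_or] at ha
    have hcard : (insert a F).card = j + 1 := by rw [Finset.card_insert_of_notMem ha.1, hF]
    obtain ⟨τ, ⟨τ', rfl⟩, hτ, hlock⟩ := lock (insert a F) σ (by omega) fun b hb hbF => by
      rcases Finset.mem_insert.1 hbF with rfl | hbF
      exacts [ha.2 hb, hσ b hb hbF]
    refine ⟨insert a F, insert (insert a F) 𝓕, σ ++ τ', hcard, ?_, ?_, hτ, ?_⟩
    · rw [Finset.card_insert_of_notMem fun hmem => ha.1 (hsub _ hmem (Finset.mem_insert_self a F)),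
        h𝓕]
    · intro G hG
      rcases Finset.mem_insert.1 hG with rfl | hG
      exacts [subset_rfl, (hsub G hG).trans (Finset.subset_insert a F)]
    · intro ρ hρ G hG
      rcases Finset.mem_insert.1 hG with rfl | hG
      · exact hlock ρ hρ
      · rw [List.append_assoc]
        refine hforce (τ' ++ ρ) (fun b hb hbF => ?_) G hG
        have hbF' := Finset.mem_insert_of_mem (a := b) (b := a) hbF
        exact (List.mem_append.1 hb).elim
          (fun hb => hτ b (List.mem_append_right σ hb) hbF') fun hb => hρ b hb hbF'

theorem not_listIdentifiable_of_compl_finset {U : Type*} [Countable U] [Infinite U] {k : ℕ}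
    {C : ℕ → Set U} (hsurj : ∀ F : Finset U, F.card ≤ k → ∃ i, C i = (↑F : Set U)ᶜ) :
    ¬ ListIdentifiable C k := by
  classical
  rintro ⟨A, hA⟩
  obtain ⟨_, 𝓕, σ, -, h𝓕, -, -, hforce⟩ := hA.exists_forcing hsurj le_rfl
  have hinj : Function.Injective fun G : Finset U => (↑G : Set U)ᶜ :=
    compl_injective.comp Finset.coe_injective
  have hsub : 𝓕.image (fun G : Finset U => (↑G : Set U)ᶜ) ⊆ (A (σ ++ [])).image C := by
    intro L hL
    obtain ⟨G, hG, rfl⟩ := Finset.mem_image.1 hL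
    exact Finset.mem_image.2 (hforce [] (by simp) G hG)
  have hle := (Finset.card_le_card hsub).trans (Finset.card_image_le.trans (hA.1 _))
  rw [Finset.card_image_of_injective _ hinj, h𝓕] at hle
  omega

/-- Any surjective enumeration `C` of the family
`{ℤ \ F : F ⊆ ℤ finite, |F| ≤ k}` is `(k+1)`-list identifiable but not `k`-list
identifiable in the limit; in particular, for every `k ≥ 1` there is a countable language
collection that is `(k+1)`-list identifiable but not `k`-list identifiable in the limit. -/
theorem canonical_collection_separation (k : ℕ) (hk : 1 ≤ k)
    (C : ℕ → Set ℤ)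
    (hrange : ∀ i : ℕ, ∃ F : Finset ℤ, F.card ≤ k ∧ C i = (↑F : Set ℤ)ᶜ)
    (hsurj : ∀ F : Finset ℤ, F.card ≤ k → ∃ i : ℕ, C i = (↑F : Set ℤ)ᶜ) :
    (ListIdentifiable C (k + 1) ∧ ¬ ListIdentifiable C k) ∧
      ∃ C' : ℕ → Set ℤ, (∀ i, (C' i).Nonempty) ∧
        ListIdentifiable C' (k + 1) ∧ ¬ ListIdentifiable C' k := by
  have hsep : ListIdentifiable C (k + 1) ∧ ¬ ListIdentifiable C k :=
    ⟨listIdentifiable_of_compl_finset hrange, not_listIdentifiable_of_compl_finset hsurj⟩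
  refine ⟨hsep, C, fun i => ?_, hsep⟩
  obtain ⟨F, -, hF⟩ := hrange i
  exact hF ▸ F.finite_toSet.infinite_compl.nonempty
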